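/- Let d = dim W_1 and let Q be the restriction to W_1 of the linear map α ↦ A_1 α, with characteristic polynomial P_Q. Then the linear network x(t+1) = A x(t) over F_p achieves consensus if and only if the characteristic polynomial of A equals λ^{nm−d} · P_Q(λ) and the minimal polynomial of Q divides λ^d(λ − 1). (The paper states the latter condition as: the minimal polynomial of Q has the form λ^s(λ − 1) for some 0 ≤ s ≤ d − 1.) -/

import Mathlib

open Matrix Polynomial

/-- The i-th block row sum `A_i = ∑_{j=1}^n A_{ij}` of an n×n block matrix with m×m blocks. -/
def blockRowSum {p n m : ℕ} (A : Matrix (Fin n × Fin m) (Fin n × Fin m) (ZMod p))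
    (i : Fin n) : Matrix (Fin m) (Fin m) (ZMod p) :=
  Matrix.of fun a b => ∑ j : Fin n, A (i, a) (j, b)

/-- The subspace `W_1 = {α | (A_i - A_1) A_1^t α = 0, ∀ i = 2,…,n, ∀ t = 0,…,m-1}`,
realized as a submodule of `F_p^m` (an intersection of kernels). -/
def W1 {p n m : ℕ} [NeZero n] (A : Matrix (Fin n × Fin m) (Fin n × Fin m) (ZMod p)) :
    Submodule (ZMod p) (Fin m → ZMod p) :=
  ⨅ (i : Fin n) (_ : i ≠ 0) (t : Fin m),
    LinearMap.ker
      (Matrix.mulVecLin ((blockRowSum A i - blockRowSum A 0) * blockRowSum A 0 ^ (t : ℕ)))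

open Module.Basis in
theorem charpoly_eq_restrict_mul_mapQ {K V : Type*} [Field K] [AddCommGroup V]
    [Module K V] [FiniteDimensional K V] (W : Submodule K V)
    (e : V →ₗ[K] V) (he : W ≤ W.comap e) :
    e.charpoly = (e.restrict he).charpoly * (W.mapQ W e he).charpoly := by
  let m := Module.Free.ChooseBasisIndex K W
  let bW : Module.Basis m K W := Module.Free.chooseBasis K W
  let n := Module.Free.ChooseBasisIndex K (V ⧸ W)
  let bQ : Module.Basis n K (V ⧸ W) := Module.Free.chooseBasis K (V ⧸ W)
  let b := sumQuot bW bQ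
  let A : Matrix m m K := LinearMap.toMatrix bW bW (e.restrict he)
  let B : Matrix m n K := Matrix.of fun i l ↦
    ((sumQuot bW bQ).repr (e ((sumQuot bW bQ) (Sum.inr l)))) (Sum.inl i)
  let D : Matrix n n K := LinearMap.toMatrix bQ bQ (W.mapQ W e he)
  suffices LinearMap.toMatrix b b e = Matrix.fromBlocks A B 0 D by
    rw [← LinearMap.charpoly_toMatrix e b, this, ← LinearMap.charpoly_toMatrix _ bW,
      ← LinearMap.charpoly_toMatrix _ bQ, Matrix.charpoly_fromBlocks_zero₂₁]
  ext u v
  cases u with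
  | inl i =>
    cases v with
    | inl k =>
      simp only [b, sumQuot_inl, Matrix.fromBlocks_apply₁₁, A, LinearMap.toMatrix_apply]
      apply sumQuot_repr_inl_of_mem
    | inr l => simp [b, LinearMap.toMatrix_apply, Matrix.fromBlocks_apply₁₂, B]
  | inr j =>
    cases v with
    | inl k =>
      suffices W.mkQ (e (bW k)) = 0 by simp [LinearMap.toMatrix_apply, b, this]
      rw [← LinearMap.mem_ker, Submodule.ker_mkQ]
      exact he (Submodule.coe_mem (bW k))
    | inr l =>
      simp only [LinearMap.toMatrix_apply, sumQuot_repr_inr,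
        Matrix.fromBlocks_apply₂₂, b, D]
      rw [← sumQuot_inr bW bQ l, W.mapQ_apply]
      simp

theorem mulVec_diag {p n m : ℕ} (A : Matrix (Fin n × Fin m) (Fin n × Fin m) (ZMod p))
    (α : Fin m → ZMod p) :
    A *ᵥ (fun q => α q.2) = fun q => (blockRowSum A q.1 *ᵥ α) q.2 := by
  ext ⟨i, a⟩
  simp only [Matrix.mulVec, dotProduct, blockRowSum, Matrix.of_apply, Fintype.sum_prod_type,
    Finset.sum_mul]
  exact Finset.sum_comm

theorem mem_W1 {p n m : ℕ} [NeZero n] (A : Matrix (Fin n × Fin m) (Fin n × Fin m) (ZMod p))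
    (α : Fin m → ZMod p) :
    α ∈ W1 A ↔ ∀ i : Fin n, i ≠ 0 → ∀ t : Fin m,
      ((blockRowSum A i - blockRowSum A 0) * blockRowSum A 0 ^ (t : ℕ)) *ᵥ α = 0 := by
  simp only [W1, Submodule.mem_iInf, LinearMap.mem_ker, Matrix.mulVecLin_apply]

theorem W1_row {p n m : ℕ} [NeZero n] [NeZero m]
    (A : Matrix (Fin n × Fin m) (Fin n × Fin m) (ZMod p))
    (α : Fin m → ZMod p) (h : α ∈ W1 A) (i : Fin n) :
    blockRowSum A i *ᵥ α = blockRowSum A 0 *ᵥ α := by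
  by_cases hi : i = 0
  · rw [hi]
  · have := (mem_W1 A α).1 h i hi 0
    simp only [Fin.val_zero, pow_zero, mul_one, Matrix.sub_mulVec] at this
    exact sub_eq_zero.1 this

theorem W1_of_fixed {p n m : ℕ} [NeZero n]
    (A : Matrix (Fin n × Fin m) (Fin n × Fin m) (ZMod p))
    (α : Fin m → ZMod p) (h : ∀ i, blockRowSum A i *ᵥ α = α) : α ∈ W1 A := by
  rw [mem_W1]
  intro i _ t
  have h2 : ∀ k : ℕ, blockRowSum A 0 ^ k *ᵥ α = α := by
    intro k
    induction k with
    | zero => simp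
    | succ k ih => rw [pow_succ, ← Matrix.mulVec_mulVec, h, ih]
  rw [← Matrix.mulVec_mulVec, h2, Matrix.sub_mulVec, h, h, sub_self]

/-- Corollary 3: Let `d = dim W_1` and let `Q` be the restriction to `W_1` of the
linear map `α ↦ A_1 α`, with characteristic polynomial `P_Q`. Then the network
`x(t+1) = A x(t)` over `F_p` achieves consensus if and only if
`P_A(λ) = λ^{nm - d} · P_Q(λ)` and the minimal polynomial of `Q` divides `λ^d (λ - 1)`. -/
theorem consensus_iff_charpoly_general (p n m : ℕ) [Fact p.Prime] [NeZero n] [NeZero m]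
    (A : Matrix (Fin n × Fin m) (Fin n × Fin m) (ZMod p))
    (Q : W1 A →ₗ[ZMod p] W1 A)
    (hQ : ∀ x : W1 A, (Q x : Fin m → ZMod p) = blockRowSum A 0 *ᵥ (x : Fin m → ZMod p)) :
    (∀ x0 : Fin n × Fin m → ZMod p, ∃ (T : ℕ) (α : Fin m → ZMod p), ∀ t ≥ T,
        (A ^ t) *ᵥ x0 = fun q => α q.2) ↔
      (A.charpoly = X ^ (n * m - Module.finrank (ZMod p) (W1 A)) * LinearMap.charpoly Q ∧
        minpoly (ZMod p) Q ∣ X ^ (Module.finrank (ZMod p) (W1 A)) * (X - 1)) := by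
  let emb : (Fin m → ZMod p) →ₗ[ZMod p] (Fin n × Fin m → ZMod p) :=
    LinearMap.funLeft _ _ Prod.snd
  have emb_def : ∀ α, emb α = fun q => α q.2 := fun _ => rfl
  have emb_inj : Function.Injective emb := by
    intro α β h
    ext a
    exact congrFun h ((0 : Fin n), a)
  let W := (W1 A).map emb
  have hAQ : ∀ x : W1 A, A *ᵥ emb x = emb (Q x) := by
    intro x
    rw [emb_def, mulVec_diag, hQ]
    ext q
    rw [W1_row A x x.2]
    rfl
  have hAQt : ∀ (t : ℕ) (x : W1 A), A ^ t *ᵥ emb x = emb ((Q ^ t) x) := by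
    intro t
    induction t with
    | zero => intro x; simp
    | succ t ih =>
      intro x
      rw [pow_succ, ← Matrix.mulVec_mulVec, hAQ, ih, pow_succ]
      rfl
  have he : W ≤ W.comap A.mulVecLin := by
    rintro _ ⟨α, hα, rfl⟩
    exact ⟨Q ⟨α, hα⟩, (Q ⟨α, hα⟩).2, (hAQ ⟨α, hα⟩).symm⟩
  let e : W1 A ≃ₗ[ZMod p] W := Submodule.equivMapOfInjective emb emb_inj (W1 A)
  have hconj : A.mulVecLin.restrict he = e.conj Q := by
    apply LinearMap.ext
    intro w
    obtain ⟨x, rfl⟩ := e.surjective w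
    rw [LinearEquiv.conj_apply_apply, e.symm_apply_apply]
    apply Subtype.ext
    exact hAQ x
  have hchar : A.charpoly = (W.mapQ W A.mulVecLin he).charpoly * LinearMap.charpoly Q := by
    rw [← Matrix.charpoly_mulVecLin, charpoly_eq_restrict_mul_mapQ W _ he, hconj,
      LinearEquiv.charpoly_conj, mul_comm]
  have hdim : n * m - Module.finrank (ZMod p) (W1 A)
      = Module.finrank (ZMod p) ((Fin n × Fin m → ZMod p) ⧸ W) := by
    have h1 := Submodule.finrank_quotient_add_finrank W
    have h2 := e.finrank_eq
    simp only [Module.finrank_fintype_fun_eq_card, Fintype.card_prod, Fintype.card_fin] at h1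
    omega
  have hpow : ∀ t : ℕ, A.mulVecLin ^ t = (A ^ t).mulVecLin := by
    intro t
    exact (Matrix.toLin'_pow A t).symm
  have hc : (A.charpoly = X ^ (n * m - Module.finrank (ZMod p) (W1 A)) * LinearMap.charpoly Q) ↔
      ∀ x0, ∃ N : ℕ, A ^ N *ᵥ x0 ∈ W := by
    rw [hchar, mul_left_inj' (LinearMap.charpoly_monic Q).ne_zero, hdim,
      LinearMap.charpoly_eq_X_pow_iff, (Submodule.mkQ_surjective W).forall]
    refine forall_congr' fun x => exists_congr fun N => ?_
    rw [← Submodule.mapQ_pow, Submodule.mkQ_apply, Submodule.mapQ_apply, hpow,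
      Submodule.Quotient.mk_eq_zero]
    rfl
  rw [hc]
  have hmin : (minpoly (ZMod p) Q ∣ X ^ (Module.finrank (ZMod p) (W1 A)) * (X - 1)) ↔
      ∀ x, (Q ^ (Module.finrank (ZMod p) (W1 A))) (Q x - x) = 0 := by
    rw [minpoly.dvd_iff, LinearMap.ext_iff]
    simp
  rw [hmin]
  constructor
  · intro h
    have key : ∀ x0, ∃ (T : ℕ) (α : W1 A), ∀ t ≥ T, A ^ t *ᵥ x0 = emb α := by
      intro x0
      obtain ⟨T, α, hT⟩ := h x0
      have hfix : A *ᵥ emb α = emb α := by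
        have h1 := hT (T + 1) (by omega)
        rw [pow_succ', ← Matrix.mulVec_mulVec, hT T le_rfl] at h1
        exact h1
      refine ⟨T, ⟨α, W1_of_fixed A α fun i => ?_⟩, hT⟩
      ext a
      rw [emb_def, mulVec_diag] at hfix
      exact congrFun hfix (i, a)
    constructor
    · intro x0
      obtain ⟨T, α, hT⟩ := key x0
      exact ⟨T, α, α.2, (hT T le_rfl).symm⟩
    · intro x
      obtain ⟨T, α, hT⟩ := key (emb x)
      have h1 : (Q ^ T) x = α := Subtype.ext (emb_inj (by rw [← hAQt, hT T le_rfl]))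
      have h2 : (Q ^ (T + 1)) x = α :=
        Subtype.ext (emb_inj (by rw [← hAQt, hT (T + 1) (by omega)]))
      have h3 : Q x - x ∈ LinearMap.ker (Q ^ T) := by
        rw [LinearMap.mem_ker, map_sub, h1, ← Module.End.mul_apply, ← pow_succ, h2, sub_self]
      exact Module.End.ker_pow_le_ker_pow_finrank Q T h3
  · rintro ⟨h1, h2⟩ x0
    obtain ⟨N, α, hα, hN⟩ := h1 x0
    set d := Module.finrank (ZMod p) (W1 A)
    refine ⟨d + N, (Q ^ d) ⟨α, hα⟩, fun t ht => ?_⟩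
    have hst : ∀ k, (Q ^ (k + d)) ⟨α, hα⟩ = (Q ^ d) ⟨α, hα⟩ := by
      intro k
      induction k with
      | zero => simp
      | succ k ih =>
        have h3 := h2 ⟨α, hα⟩
        rw [map_sub, ← Module.End.mul_apply, ← pow_succ, sub_eq_zero] at h3
        rw [← ih, add_right_comm, add_assoc, pow_add, Module.End.mul_apply, h3, pow_add,
          Module.End.mul_apply]
    obtain ⟨k, rfl⟩ := Nat.exists_eq_add_of_le ht
    rw [show d + N + k = (k + d) + N by omega, pow_add, ← Matrix.mulVec_mulVec, ← hN]
    have := hAQt (k + d) ⟨α, hα⟩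
    rw [hst] at this
    exact this
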